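/- Let δ ∈ ℝ and let X^a, X⁰ be smooth real functions on ℝⁿ. For λ ∈ ℝ define the first-order operator D_λ f = X^a∂_a f + λX⁰·f on smooth functions. Then for every λ ∈ ℝ and all compactly supported smooth f, g on ℝⁿ: ∫_{ℝⁿ}(D_λ f)·g dx + ∫_{ℝⁿ} f·(D_{1−λ−δ} g) dx = ∫_{ℝⁿ} ((1−δ)X⁰ − ∂_a X^a)·f·g dx. In particular, the family is anti-self-adjoint — ∫(D_λ f)·g dx = −∫ f·(D_{1−λ−δ} g) dx for all λ, f, g — if and only if ∂_a X^a + (δ−1)X⁰ = 0 identically. -/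

import Mathlib

open MeasureTheory Real

/-- Partial derivative of a function on ℝⁿ in the direction of the `a`-th coordinate. -/
noncomputable def pd {n : ℕ} (a : Fin n) (f : (Fin n → ℝ) → ℝ) : (Fin n → ℝ) → ℝ :=
  fun x => fderiv ℝ f x (Pi.single a 1)

lemma contDiff_pd {n : ℕ} (a : Fin n) {f : (Fin n → ℝ) → ℝ} (hf : ContDiff ℝ (⊤ : ℕ∞) f) :
    ContDiff ℝ (⊤ : ℕ∞) (pd a f) :=
  (hf.fderiv_right (m := (⊤ : ℕ∞)) (by simp)).clm_apply contDiff_const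

lemma pd_mul {n : ℕ} (a : Fin n) {f g : (Fin n → ℝ) → ℝ} (hf : ContDiff ℝ (⊤ : ℕ∞) f)
    (hg : ContDiff ℝ (⊤ : ℕ∞) g) (x : Fin n → ℝ) :
    pd a (fun y => f y * g y) x = pd a f x * g x + f x * pd a g x := by
  have hf' : DifferentiableAt ℝ f x := (hf.differentiable (by simp)) x
  have hg' : DifferentiableAt ℝ g x := (hg.differentiable (by simp)) x
  simp only [pd, fderiv_fun_mul hf' hg', add_apply, smul_apply, smul_eq_mul]
  ring

lemma hasCompactSupport_pd {n : ℕ} (a : Fin n) {u : (Fin n → ℝ) → ℝ}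
    (hc : HasCompactSupport u) : HasCompactSupport (pd a u) :=
  hc.fderiv_apply (𝕜 := ℝ) _

/-- The integral of a partial derivative of a compactly supported smooth function vanishes. -/
lemma integral_pd_eq_zero {n : ℕ} (a : Fin n) {u : (Fin n → ℝ) → ℝ}
    (hu : ContDiff ℝ (⊤ : ℕ∞) u) (hc : HasCompactSupport u) : ∫ x, pd a u x = 0 := by
  have hi : Integrable (fun x => fderiv ℝ u x (Pi.single a 1)) :=
    (contDiff_pd a hu).continuous.integrable_of_hasCompactSupport (hasCompactSupport_pd a hc)
  have h := integral_mul_fderiv_eq_neg_fderiv_mul_of_integrable (𝕜 := ℝ)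
    (μ := (volume : Measure (Fin n → ℝ))) (f := fun _ => (1 : ℝ)) (g := u)
    (v := Pi.single a 1) (by simp)
    (by simpa only [one_mul] using hi)
    (by simpa using hu.continuous.integrable_of_hasCompactSupport hc)
    (by fun_prop) (fun x _ => hu.differentiable (by simp) x)
  simpa [pd] using h

/-- The defect of anti-self-adjointness is the multiplication by `(1 - δ) X⁰ - ∂ₐXᵃ`. -/
lemma integral_add_integral_eq_defect {n : ℕ} (δ : ℝ)
    {X : Fin n → (Fin n → ℝ) → ℝ} {X0 : (Fin n → ℝ) → ℝ}
    (hX : ∀ a, ContDiff ℝ (⊤ : ℕ∞) (X a)) (hX0 : ContDiff ℝ (⊤ : ℕ∞) X0) (lam : ℝ)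
    {f g : (Fin n → ℝ) → ℝ} (hf : ContDiff ℝ (⊤ : ℕ∞) f) (hfc : HasCompactSupport f)
    (hg : ContDiff ℝ (⊤ : ℕ∞) g) (hgc : HasCompactSupport g) :
    (∫ x, (∑ a, X a x * pd a f x + lam * X0 x * f x) * g x)
        + (∫ x, f x * (∑ a, X a x * pd a g x + (1 - lam - δ) * X0 x * g x))
      = ∫ x, ((1 - δ) * X0 x - ∑ a, pd a (X a) x) * f x * g x := by
  have cX a := (hX a).continuous
  have cpX a := (contDiff_pd a (hX a)).continuous
  have cX0 := hX0.continuous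
  have cf := hf.continuous
  have cg := hg.continuous
  have cpf a := (contDiff_pd a hf).continuous
  have cpg a := (contDiff_pd a hg).continuous
  have hfg : ContDiff ℝ (⊤ : ℕ∞) (fun x => f x * g x) := hf.mul hg
  have hu a : ContDiff ℝ (⊤ : ℕ∞) (fun x => X a x * (f x * g x)) := (hX a).mul hfg
  have hc a : HasCompactSupport (fun x => X a x * (f x * g x)) :=
    (hgc.mul_left (f := f)).mul_left (f := X a)
  have i1 : Integrable (fun x => (∑ a, X a x * pd a f x + lam * X0 x * f x) * g x) :=
    Continuous.integrable_of_hasCompactSupport (by fun_prop) hgc.mul_left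
  have i2 : Integrable
      (fun x => f x * (∑ a, X a x * pd a g x + (1 - lam - δ) * X0 x * g x)) :=
    Continuous.integrable_of_hasCompactSupport (by fun_prop) hfc.mul_right
  have i3 : Integrable (fun x => ((1 - δ) * X0 x - ∑ a, pd a (X a) x) * f x * g x) :=
    Continuous.integrable_of_hasCompactSupport (by fun_prop) hgc.mul_left
  have i4 a : Integrable (pd a (fun x => X a x * (f x * g x))) :=
    (contDiff_pd a (hu a)).continuous.integrable_of_hasCompactSupport
      (hasCompactSupport_pd a (hc a))
  have hdiv : ∫ x, ∑ a, pd a (fun x => X a x * (f x * g x)) x = 0 := by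
    rw [integral_finsetSum _ fun a _ => i4 a]
    exact Finset.sum_eq_zero fun a _ => integral_pd_eq_zero a (hu a) (hc a)
  rw [← integral_add i1 i2, ← sub_eq_zero, ← integral_sub (i1.fun_add i2) i3, ← hdiv]
  congr 1 with x
  have e a : pd a (fun x => X a x * (f x * g x)) x =
      pd a (X a) x * (f x * g x) + (X a x * pd a f x * g x + f x * (X a x * pd a g x)) := by
    rw [pd_mul a (hX a) hfg, pd_mul a hf hg]
    ring
  simp only [e, Finset.sum_add_distrib, ← Finset.sum_mul, ← Finset.mul_sum]
  ring

/-- A continuous function whose products with pairs of test functions all have vanishing integral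
is zero. -/
lemma eq_zero_of_integral_mul_mul_eq_zero {n : ℕ} {h : (Fin n → ℝ) → ℝ} (hh : Continuous h)
    (H : ∀ f g : (Fin n → ℝ) → ℝ, ContDiff ℝ (⊤ : ℕ∞) f → HasCompactSupport f →
      ContDiff ℝ (⊤ : ℕ∞) g → HasCompactSupport g → ∫ x, h x * f x * g x = 0)
    (x : Fin n → ℝ) : h x = 0 := by
  let b : ContDiffBump x := ⟨1, 2, one_pos, one_lt_two⟩
  have hc : Continuous (fun y => h y * b y) := hh.mul b.continuous
  have hae : ∀ᵐ y, h y * b y = 0 :=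
    ae_eq_zero_of_integral_contDiff_smul_eq_zero hc.locallyIntegrable fun g hg hgc => by
      simpa [mul_comm, mul_left_comm, mul_assoc] using
        H b g b.contDiff b.hasCompactSupport hg hgc
  have hzero : (fun y => h y * b y) = fun _ => 0 :=
    (Continuous.ae_eq_iff_eq volume hc continuous_const).1 hae
  have hb : b x = 1 := b.one_of_mem_closedBall (by simp [b])
  simpa [hb] using congrFun hzero x

/-- for the family `D_λ f = X^a∂_a f + λX⁰f` representing a derivation of
weight `δ` of the algebra of densities, the defect of anti-self-adjointness with respect
to the canonical scalar product is the multiplication by `(1−δ)X⁰ − ∂_a X^a`; the family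
is anti-self-adjoint iff the canonical divergence `∂_a X^a + (δ−1)X⁰` vanishes. -/
theorem statement17 (n : ℕ) (δ : ℝ)
    (X : Fin n → (Fin n → ℝ) → ℝ) (X0 : (Fin n → ℝ) → ℝ)
    (hX : ∀ a, ContDiff ℝ (⊤ : ℕ∞) (X a)) (hX0 : ContDiff ℝ (⊤ : ℕ∞) X0) :
    -- the integral identity:
    (∀ lam : ℝ, ∀ f g : (Fin n → ℝ) → ℝ,
      ContDiff ℝ (⊤ : ℕ∞) f → HasCompactSupport f → ContDiff ℝ (⊤ : ℕ∞) g → HasCompactSupport g →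
      (∫ x, (∑ a, X a x * pd a f x + lam * X0 x * f x) * g x)
        + (∫ x, f x * (∑ a, X a x * pd a g x + (1 - lam - δ) * X0 x * g x))
      = ∫ x, ((1 - δ) * X0 x - ∑ a, pd a (X a) x) * f x * g x)
    ∧
    -- anti-self-adjointness iff the canonical divergence vanishes:
    ((∀ lam : ℝ, ∀ f g : (Fin n → ℝ) → ℝ,
        ContDiff ℝ (⊤ : ℕ∞) f → HasCompactSupport f → ContDiff ℝ (⊤ : ℕ∞) g → HasCompactSupport g →
        ∫ x, (∑ a, X a x * pd a f x + lam * X0 x * f x) * g x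
          = - ∫ x, f x * (∑ a, X a x * pd a g x + (1 - lam - δ) * X0 x * g x))
      ↔ (∀ x, ∑ a, pd a (X a) x + (δ - 1) * X0 x = 0)) := by
  refine ⟨fun lam f g hf hfc hg hgc =>
    integral_add_integral_eq_defect δ hX hX0 lam hf hfc hg hgc, fun H x => ?_,
    fun H lam f g hf hfc hg hgc => ?_⟩
  · have hcont : Continuous (fun x => (1 - δ) * X0 x - ∑ a, pd a (X a) x) := by
      have cX0 := hX0.continuous
      have cpX a := (contDiff_pd a (hX a)).continuous
      fun_prop
    have hz := eq_zero_of_integral_mul_mul_eq_zero hcont (fun f g hf hfc hg hgc => by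
      rw [← integral_add_integral_eq_defect δ hX hX0 0 hf hfc hg hgc, H 0 f g hf hfc hg hgc,
        neg_add_cancel]) x
    linear_combination -hz
  · rw [eq_neg_iff_add_eq_zero, integral_add_integral_eq_defect δ hX hX0 lam hf hfc hg hgc]
    have hz x : (1 - δ) * X0 x - ∑ a, pd a (X a) x = 0 := by linear_combination -H x
    simp [hz]
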